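/- arXiv:1809.09288 — 6 statements merged into one kernel-verified Lean document; each statement's English description precedes it below -/
import Mathlib

section
/- For every connected graph G, the broadcast independence number satisfies α_b(G) ≤ 4α(G); equivalently, every independent broadcast f on G has weight Σ_{x∈V(G)} f(x) ≤ 4α(G). -/
open scoped Classical

variable {V : Type*}

/-- The eccentricity of a vertex `x` in a finite graph `G`. -/
noncomputable def graphEcc [Fintype V] (G : SimpleGraph V) (x : V) : ℕ :=
  Finset.univ.sup fun y => G.dist x y

/-- The diameter of a finite graph `G`. -/
noncomputable def graphDiam [Fintype V] (G : SimpleGraph V) : ℕ :=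
  Finset.univ.sup fun p : V × V => G.dist p.1 p.2

/-- `f` is an independent broadcast on `G`: (B1) `f x` is at most the eccentricity of `x`,
and (B2) any two distinct vertices with positive values are at distance larger than both values. -/
def IsIndepBroadcast [Fintype V] (G : SimpleGraph V) (f : V → ℕ) : Prop :=
  (∀ x, f x ≤ graphEcc G x) ∧
  (∀ x y, x ≠ y → 0 < f x → 0 < f y → max (f x) (f y) < G.dist x y)

/-- The broadcast independence number of `G`: the maximum weight of an independent broadcast. -/
noncomputable def broadcastIndepNum [Fintype V] (G : SimpleGraph V) : ℕ :=
  sSup {w | ∃ f : V → ℕ, IsIndepBroadcast G f ∧ ∑ x, f x = w}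

/-- The independence number of `G`: the maximum size of a set of pairwise nonadjacent vertices. -/
noncomputable def indepNum [Fintype V] (G : SimpleGraph V) : ℕ :=
  sSup {n | ∃ S : Finset V, (∀ x ∈ S, ∀ y ∈ S, x ≠ y → ¬ G.Adj x y) ∧ S.card = n}

/-- The induced subgraph of `G` on `S` is a `k`-strip with partition `(B 0, …, B k)`. -/
def IsStripIn (G : SimpleGraph V) (S : Set V) (k : ℕ) (B : ℕ → Set V) : Prop :=
  (∀ i ≤ k, (B i).Nonempty ∧ B i ⊆ S) ∧
  (∀ i ≤ k, ∀ j ≤ k, i ≠ j → Disjoint (B i) (B j)) ∧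
  (S = ⋃ i ∈ Set.Iic k, B i) ∧
  (∀ i ≤ k, ∀ u ∈ B i, ∀ v ∈ B i, u ≠ v → G.Adj u v) ∧
  (∃ x, B 0 = {x}) ∧
  (∀ x, B 0 = {x} → ∀ i ≤ k, ∀ y, y ∈ B i → ∀ (hx : x ∈ S) (hy : y ∈ S),
      (G.induce S).dist ⟨x, hx⟩ ⟨y, hy⟩ = i) ∧
  (∀ i < k, Even i → ∀ u ∈ B i, ∀ v ∈ B (i + 1), G.Adj u v)

/-- `G` belongs to the class `𝒢₂(k)`: it is a connected graph arising from the disjoint union of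
two `(2k+1)`-strips by adding some edges between the two last cliques. -/
def MemG2 (G : SimpleGraph V) (k : ℕ) : Prop :=
  G.Connected ∧
  ∃ (S₁ S₂ : Set V) (B₁ B₂ : ℕ → Set V),
    Disjoint S₁ S₂ ∧ S₁ ∪ S₂ = Set.univ ∧
    IsStripIn G S₁ (2 * k + 1) B₁ ∧ IsStripIn G S₂ (2 * k + 1) B₂ ∧
    (∀ u v, G.Adj u v → (u ∈ S₁ ∧ v ∈ S₁) ∨ (u ∈ S₂ ∧ v ∈ S₂) ∨
      (u ∈ B₁ (2 * k + 1) ∧ v ∈ B₂ (2 * k + 1)) ∨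
      (u ∈ B₂ (2 * k + 1) ∧ v ∈ B₁ (2 * k + 1)))

/-- `G` arises from the disjoint union of `ℓ` `2k`-strips (on the sets `S j`, with partitions
`B j`) and a possibly empty set `R` of vertices, by adding all possible edges within
`R ∪ ⋃ j, B j (2k)`. -/
def MemG0With (G : SimpleGraph V) (k : ℕ) {ℓ : ℕ} (S : Fin ℓ → Set V)
    (B : Fin ℓ → ℕ → Set V) (R : Set V) : Prop :=
  (R ∪ ⋃ j, S j) = Set.univ ∧
  (∀ j, Disjoint R (S j)) ∧
  (Pairwise fun j j' => Disjoint (S j) (S j')) ∧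
  (∀ j, IsStripIn G (S j) (2 * k) (B j)) ∧
  (∀ u v, u ≠ v → u ∈ R ∪ ⋃ j, B j (2 * k) → v ∈ R ∪ ⋃ j, B j (2 * k) → G.Adj u v) ∧
  (∀ u v, G.Adj u v → (∃ j, u ∈ S j ∧ v ∈ S j) ∨
      ((u ∈ R ∪ ⋃ j, B j (2 * k)) ∧ (v ∈ R ∪ ⋃ j, B j (2 * k))))

/-- `G` belongs to the class `𝒢₀(k, ℓ)`. -/
def MemG0 (G : SimpleGraph V) (k ℓ : ℕ) : Prop :=
  ∃ (S : Fin ℓ → Set V) (B : Fin ℓ → ℕ → Set V) (R : Set V), MemG0With G k S B R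

theorem exists_dist_eq_aux {V : Type*} (G : SimpleGraph V) (hG : G.Connected) {y x : V}
    (p : G.Walk y x) (k : ℕ) (hk : k ≤ G.dist x y) : ∃ z, G.dist x z = k := by
  induction p with
  | @nil u => exact ⟨u, by simp at hk ⊢; exact hk.symm⟩
  | @cons u v w h p ih =>
    by_cases h' : k ≤ G.dist w v
    · exact ih h'
    · refine ⟨u, ?_⟩
      have h1 := hG.dist_triangle (u := w) (v := v) (w := u)
      have h2 : G.dist v u = 1 := SimpleGraph.dist_eq_one_iff_adj.2 h.symm
      omega

theorem weight_le_aux {V : Type*} [Fintype V] (G : SimpleGraph V) (hG : G.Connected)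
    (f : V → ℕ) (hf : IsIndepBroadcast G f) : ∑ x, f x ≤ 4 * indepNum G := by
  obtain ⟨h1, h2⟩ := hf
  have hex : ∀ x k, ∃ z, k ≤ graphEcc G x → G.dist x z = k := by
    intro x k
    by_cases hk : k ≤ graphEcc G x
    · obtain ⟨y, -, hy⟩ := Finset.exists_mem_eq_sup (Finset.univ : Finset V) ⟨x, Finset.mem_univ x⟩
        (fun y => G.dist x y)
      obtain ⟨w⟩ := hG.preconnected y x
      obtain ⟨z, hz⟩ := exists_dist_eq_aux G hG w k (by unfold graphEcc at hk; omega)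
      exact ⟨z, fun _ => hz⟩
    · exact ⟨x, fun h => absurd h hk⟩
  choose p hp using hex
  let T : Finset (Σ _ : V, ℕ) :=
    (Finset.univ.filter (fun x => 0 < f x)).sigma (fun x => Finset.range ((f x - 1) / 4 + 1))
  let q : (Σ _ : V, ℕ) → V := fun a => p a.1 (2 * a.2)
  have key : ∀ a ∈ T, ∀ b ∈ T, a ≠ b → 2 ≤ G.dist (q a) (q b) := by
    rintro ⟨x, i⟩ ha ⟨y, j⟩ hb hab
    simp only [T, Finset.mem_sigma, Finset.mem_filter, Finset.mem_univ, true_and,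
      Finset.mem_range] at ha hb
    have e1 : G.dist x (q ⟨x, i⟩) = 2 * i := hp x (2 * i) (by have := h1 x; omega)
    have e2 : G.dist y (q ⟨y, j⟩) = 2 * j := hp y (2 * j) (by have := h1 y; omega)
    generalize q ⟨x, i⟩ = u at *
    generalize q ⟨y, j⟩ = v at *
    by_cases hxy : x = y
    · subst hxy
      have hij : i ≠ j := fun h => hab (by rw [h])
      have t1 := hG.dist_triangle (u := x) (v := u) (w := v)
      have t2 := hG.dist_triangle (u := x) (v := v) (w := u)
      rw [G.dist_comm (u := v) (v := u)] at t2
      omega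
    · have t0 := h2 x y hxy ha.1 hb.1
      have t1 := hG.dist_triangle (u := x) (v := u) (w := y)
      have t2 := hG.dist_triangle (u := u) (v := v) (w := y)
      rw [G.dist_comm (u := v) (v := y)] at t2
      omega
  have hinj : Set.InjOn q T := by
    intro a ha b hb hab
    by_contra hne
    have := key a ha b hb hne
    rw [hab, SimpleGraph.dist_self] at this
    omega
  have hcard : (T.image q).card ≤ indepNum G := by
    apply le_csSup
    · refine ⟨Fintype.card V, ?_⟩
      rintro n ⟨S, -, rfl⟩
      exact Finset.card_le_univ S
    · refine ⟨T.image q, ?_, rfl⟩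
      intro u hu v hv huv hadj
      obtain ⟨a, ha, rfl⟩ := Finset.mem_image.1 hu
      obtain ⟨b, hb, rfl⟩ := Finset.mem_image.1 hv
      have := key a ha b hb (fun h => huv (by rw [h]))
      rw [SimpleGraph.dist_eq_one_iff_adj.2 hadj] at this
      omega
  rw [Finset.card_image_of_injOn hinj, Finset.card_sigma] at hcard
  simp only [Finset.card_range] at hcard
  refine le_trans ?_ (Nat.mul_le_mul_left 4 hcard)
  rw [Finset.mul_sum, Finset.sum_filter]
  apply Finset.sum_le_sum
  intro x _
  split_ifs <;> omega

/-- For every connected graph `G`, `α_b(G) ≤ 4 α(G)`; equivalently, every independent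
broadcast on `G` has weight at most `4 α(G)`. -/
theorem stmt1 {V : Type*} [Fintype V] (G : SimpleGraph V) (hG : G.Connected) :
    broadcastIndepNum G ≤ 4 * indepNum G ∧
      ∀ f : V → ℕ, IsIndepBroadcast G f → ∑ x, f x ≤ 4 * indepNum G := by
  refine ⟨?_, weight_le_aux G hG⟩
  apply csSup_le'
  rintro w ⟨f, hf, rfl⟩
  exact weight_le_aux G hG f hf
end

section
/- Let G be a connected graph such that G has diameter at least 3 or α(G) ≥ 3, and let f be an optimal independent broadcast on G (an independent broadcast of weight α_b(G)). Then α_b(G) ≤ 4α(G) − 4·min{1, 2α(G)/(f_max + 2)}, where f_max = max{f(x) : x ∈ V(G)}. -/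
open scoped Classical

variable {V : Type*}

theorem aux_exists_dist [Fintype V] (G : SimpleGraph V) (hG : G.Connected) (x : V) (d : ℕ)
    (hd : d ≤ graphEcc G x) : ∃ z, G.dist x z = d := by
  have hne : (Finset.univ : Finset V).Nonempty := ⟨x, Finset.mem_univ x⟩
  obtain ⟨y, -, hy⟩ := Finset.exists_mem_eq_sup Finset.univ hne (fun y => G.dist x y)
  obtain ⟨p, hp⟩ := hG.exists_walk_length_eq_dist x y
  have hd' : d ≤ G.dist x y := by
    unfold graphEcc at hd
    rw [hy] at hd
    exact hd
  refine ⟨p.getVert d, ?_⟩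
  have h1 := SimpleGraph.dist_le (p.take d)
  have h2 := SimpleGraph.dist_le (p.drop d)
  have h3 := hG.dist_triangle (u := x) (v := p.getVert d) (w := y)
  rw [SimpleGraph.Walk.take_length] at h1
  rw [SimpleGraph.Walk.drop_length] at h2
  omega

theorem aux_card_le [Fintype V] (G : SimpleGraph V) (S : Finset V)
    (hS : ∀ x ∈ S, ∀ y ∈ S, x ≠ y → ¬ G.Adj x y) : S.card ≤ indepNum G := by
  unfold indepNum
  apply le_csSup
  · refine ⟨Fintype.card V, ?_⟩
    rintro n ⟨T, -, rfl⟩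
    exact Finset.card_le_univ T
  · exact ⟨S, hS, rfl⟩

theorem aux_pack [Fintype V] (G : SimpleGraph V) (hG : G.Connected) (c : V → ℕ)
    (h1 : ∀ x, 0 < c x → 2 * (c x - 1) ≤ graphEcc G x)
    (h2 : ∀ x y, x ≠ y → 0 < c x → 0 < c y →
      2 * (c x - 1) + 2 * (c y - 1) + 2 ≤ G.dist x y) :
    ∑ x, c x ≤ indepNum G := by
  have hp : ∀ x : V, ∀ i : ℕ, ∃ z, i < c x → G.dist x z = 2 * i := by
    intro x i
    by_cases hi : i < c x
    · obtain ⟨z, hz⟩ := aux_exists_dist G hG x (2 * i)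
        (le_trans (by omega) (h1 x (by omega)))
      exact ⟨z, fun _ => hz⟩
    · exact ⟨x, fun h => absurd h hi⟩
  choose p hp using hp
  let T : Finset (Σ _ : V, ℕ) := Finset.univ.sigma (fun x => Finset.range (c x))
  have key : ∀ a ∈ T, ∀ b ∈ T, a ≠ b → 2 ≤ G.dist (p a.1 a.2) (p b.1 b.2) := by
    rintro ⟨x, i⟩ ha ⟨y, j⟩ hb hab
    simp only [T, Finset.mem_sigma, Finset.mem_univ, true_and, Finset.mem_range] at ha hb
    have e1 := hp x i ha
    have e2 := hp y j hb
    show 2 ≤ G.dist (p x i) (p y j)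
    by_cases hxy : x = y
    · subst hxy
      have hij : i ≠ j := by
        rintro rfl
        exact hab rfl
      have t1 := hG.dist_triangle (u := x) (v := p x i) (w := p x j)
      have t2 := hG.dist_triangle (u := x) (v := p x j) (w := p x i)
      rw [SimpleGraph.dist_comm (u := p x j)] at t2
      omega
    · have t1 := hG.dist_triangle (u := x) (v := p x i) (w := y)
      have t2 := hG.dist_triangle (u := p x i) (v := p y j) (w := y)
      rw [SimpleGraph.dist_comm (u := p y j)] at t2
      have := h2 x y hxy (by omega) (by omega)
      omega
  have hinj : Set.InjOn (fun a : (Σ _ : V, ℕ) => p a.1 a.2) T := by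
    intro a ha b hb hab
    by_contra hne
    have := key a ha b hb hne
    simp only at hab
    rw [hab, SimpleGraph.dist_self] at this
    omega
  have hc : (T.image (fun a : (Σ _ : V, ℕ) => p a.1 a.2)).card = ∑ x, c x := by
    rw [Finset.card_image_of_injOn hinj]
    simp [T]
  rw [← hc]
  apply aux_card_le
  intro u hu v hv huv hadj
  rw [Finset.mem_image] at hu hv
  obtain ⟨a, ha, rfl⟩ := hu
  obtain ⟨b, hb, rfl⟩ := hv
  have hab : a ≠ b := by
    rintro rfl
    exact huv rfl
  have := key a ha b hb hab
  rw [SimpleGraph.dist_eq_one_iff_adj.mpr hadj] at this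
  omega

theorem aux_single [Fintype V] (G : SimpleGraph V) (hG : G.Connected) (x : V) (d : ℕ)
    (hd : d ≤ graphEcc G x) : d / 2 + 1 ≤ indepNum G := by
  have := aux_pack G hG (fun y => if y = x then d / 2 + 1 else 0)
    (by
      intro y hy
      by_cases h : y = x
      · subst h
        simp only [if_true]
        omega
      · simp [h] at hy)
    (by
      intro y z hyz hy hz
      by_cases h : y = x
      · by_cases h' : z = x
        · exact absurd (h.trans h'.symm) hyz
        · simp [h'] at hz
      · simp [h] at hy)
  simpa using this

theorem aux_main [Fintype V] (G : SimpleGraph V) (hG : G.Connected)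
    (hda : 3 ≤ graphDiam G ∨ 3 ≤ indepNum G)
    (f : V → ℕ) (hf : IsIndepBroadcast G f) :
    ∑ x, f x + 4 ≤ 4 * indepNum G := by
  obtain ⟨hB1, hB2⟩ := hf
  have hα : 2 ≤ indepNum G := by
    rcases hda with h | h
    · obtain ⟨v⟩ := hG.nonempty
      obtain ⟨q, -, hq⟩ := Finset.exists_mem_eq_sup (Finset.univ : Finset (V × V))
        ⟨(v, v), Finset.mem_univ _⟩ (fun p => G.dist p.1 p.2)
      have h3 : 3 ≤ G.dist q.1 q.2 := by
        unfold graphDiam at h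
        rw [hq] at h
        exact h
      have h4 : G.dist q.1 q.2 ≤ graphEcc G q.1 :=
        Finset.le_sup (f := fun y => G.dist q.1 y) (Finset.mem_univ q.2)
      exact aux_single G hG q.1 3 (h3.trans h4)
    · omega
  have : Nonempty V := hG.nonempty
  obtain ⟨x0, hx0⟩ := Finite.exists_max f
  by_cases hone : ∀ y, y ≠ x0 → f y = 0
  · have hs : ∑ x, f x = f x0 :=
      Finset.sum_eq_single x0 (fun y _ hy => hone y hy) (by simp)
    have := aux_single G hG x0 (f x0) (hB1 x0)
    omega
  push Not at hone
  obtain ⟨y1, hy1, hfy1⟩ := hone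
  have hx0pos : 0 < f x0 := by
    have := hx0 y1
    omega
  have hd1 := hB2 x0 y1 hy1.symm hx0pos (by omega)
  have hd2 : G.dist x0 y1 ≤ graphEcc G x0 :=
    Finset.le_sup (f := fun y => G.dist x0 y) (Finset.mem_univ y1)
  have hd3 : f x0 + 1 ≤ graphEcc G x0 := by
    have := le_max_left (f x0) (f y1)
    omega
  by_cases hex : ∃ y, y ≠ x0 ∧ 0 < f y ∧ f x0 + 1 < 2 * ((f x0 + 3) / 4) + 2 * ((f y + 3) / 4)
  · obtain ⟨y, hy, hfy, hlt⟩ := hex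
    have hle := hx0 y
    have hpk := aux_pack G hG (fun x => (f x + 3) / 4)
      (by
        intro x hx
        have := hB1 x
        omega)
      (by
        intro x z hxz hx hz
        have h := hB2 x z hxz (by omega) (by omega)
        have := le_max_left (f x) (f z)
        have := le_max_right (f x) (f z)
        omega)
    have hsum : ∑ x, (f x + ((if x = x0 then 2 else 0) + (if x = y then 2 else 0))) ≤
        ∑ x, 4 * ((f x + 3) / 4) := by
      apply Finset.sum_le_sum
      intro x _
      by_cases h1 : x = x0
      · subst h1
        simp only [if_true, if_neg hy.symm]
        omega
      · by_cases h2 : x = y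
        · subst h2
          simp only [if_true, if_neg h1]
          omega
        · simp only [if_neg h1, if_neg h2]
          omega
    rw [Finset.sum_add_distrib, Finset.sum_add_distrib, ← Finset.mul_sum] at hsum
    simp only [Finset.sum_ite_eq', Finset.mem_univ, if_true] at hsum
    omega
  · push Not at hex
    have hpk := aux_pack G hG (fun x => (f x + 3) / 4 + (if x = x0 then 1 else 0))
      (by
        intro x hx
        have := hB1 x
        by_cases h1 : x = x0
        · subst h1
          simp only [if_true]
          omega
        · simp only [if_neg h1] at hx ⊢
          omega)
      (by
        intro x z hxz hx hz
        by_cases h1 : x = x0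
        · subst h1
          simp only [if_neg hxz.symm, if_true] at hx hz ⊢
          have h := hB2 x z hxz (by omega) (by omega)
          have := hex z hxz.symm (by omega)
          have := le_max_left (f x) (f z)
          omega
        · by_cases h2 : z = x0
          · subst h2
            simp only [if_neg hxz, if_true] at hx hz ⊢
            have h := hB2 x z hxz (by omega) (by omega)
            have := hex x hxz (by omega)
            have := le_max_right (f x) (f z)
            omega
          · simp only [if_neg h1, if_neg h2] at hx hz ⊢
            have h := hB2 x z hxz (by omega) (by omega)
            have := le_max_left (f x) (f z)
            have := le_max_right (f x) (f z)
            omega)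
    rw [Finset.sum_add_distrib] at hpk
    simp only [Finset.sum_ite_eq', Finset.mem_univ, if_true] at hpk
    have hsum : ∑ x, f x ≤ ∑ x, 4 * ((f x + 3) / 4) :=
      Finset.sum_le_sum (fun x _ => by omega)
    rw [← Finset.mul_sum] at hsum
    omega

/-- If `G` is connected with diameter at least `3` or `α(G) ≥ 3`, and `f` is an
optimal independent broadcast on `G`, then
`α_b(G) ≤ 4 α(G) − 4 min {1, 2 α(G) / (f_max + 2)}`. -/
theorem stmt2 {V : Type*} [Fintype V] (G : SimpleGraph V) (hG : G.Connected)
    (hda : 3 ≤ graphDiam G ∨ 3 ≤ indepNum G)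
    (f : V → ℕ) (hf : IsIndepBroadcast G f) (hopt : ∑ x, f x = broadcastIndepNum G) :
    (broadcastIndepNum G : ℝ) ≤
      4 * indepNum G - 4 * min 1 (2 * indepNum G / (((Finset.univ.sup f : ℕ) : ℝ) + 2)) := by
  rw [← hopt]
  have h := aux_main G hG hda f hf
  have h' : ((∑ x, f x : ℕ) : ℝ) + 4 ≤ 4 * indepNum G := by exact_mod_cast h
  have hm := min_le_left (1 : ℝ) (2 * indepNum G / (((Finset.univ.sup f : ℕ) : ℝ) + 2))
  linarith
end

section
/- For every positive integer k and every graph G in the class 𝒢_2(k), the independence number satisfies α(G) = 2k + 2. -/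
open scoped Classical

variable {V : Type*}

theorem strip_step (G : SimpleGraph V) (S : Set V) (K : ℕ) (B : ℕ → Set V)
    (h : IsStripIn G S K B) (i j : ℕ) (hi : i ≤ K) (hj : j ≤ K) (u v : V)
    (hu : u ∈ B i) (hv : v ∈ B j) (huv : G.Adj u v) : i ≤ j + 1 := by
  obtain ⟨h1, h2, h3, h4, ⟨x, hx⟩, h6, h7⟩ := h
  have hxS : x ∈ S := (h1 0 (Nat.zero_le _)).2 (by rw [hx]; rfl)
  have huS : u ∈ S := (h1 i hi).2 hu
  have hvS : v ∈ S := (h1 j hj).2 hv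
  have du := h6 x hx i hi u hu hxS huS
  have dv := h6 x hx j hj v hv hxS hvS
  have hr : (G.induce S).Reachable ⟨x, hxS⟩ ⟨v, hvS⟩ := by
    by_cases hj0 : j = 0
    · subst hj0
      rw [hx] at hv
      have : v = x := hv
      subst this
      exact SimpleGraph.Reachable.refl _
    · by_contra hn
      exact hj0 (dv.symm.trans (SimpleGraph.dist_eq_zero_of_not_reachable hn))
  obtain ⟨p, hp⟩ := hr.exists_walk_length_eq_dist
  have ha : (G.induce S).Adj ⟨v, hvS⟩ ⟨u, huS⟩ := huv.symm
  have := SimpleGraph.dist_le (p.concat ha)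
  rw [SimpleGraph.Walk.length_concat] at this
  omega

theorem strip_level (G : SimpleGraph V) (S : Set V) (K : ℕ) (B : ℕ → Set V)
    (h : IsStripIn G S K B) :
    ∃ d : V → ℕ, ∀ v ∈ S, d v ≤ K ∧ v ∈ B (d v) := by
  obtain ⟨h1, h2, h3, -⟩ := h
  have : ∀ v, ∃ i, v ∈ S → i ≤ K ∧ v ∈ B i := by
    intro v
    by_cases hv : v ∈ S
    · rw [h3] at hv
      simp only [Set.mem_iUnion, Set.mem_Iic] at hv
      obtain ⟨i, hi, hv⟩ := hv
      exact ⟨i, fun _ => ⟨hi, hv⟩⟩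
    · exact ⟨0, fun h => absurd h hv⟩
  choose d hd using this
  exact ⟨d, hd⟩

theorem strip_clique (G : SimpleGraph V) (S : Set V) (k : ℕ) (B : ℕ → Set V)
    (h : IsStripIn G S (2 * k + 1) B) (i j : ℕ) (hi : i ≤ 2 * k + 1) (hj : j ≤ 2 * k + 1)
    (hij : i / 2 = j / 2) (u v : V)
    (hu : u ∈ B i) (hv : v ∈ B j) (huv : u ≠ v) : G.Adj u v := by
  obtain ⟨h1, h2, h3, h4, -, -, h7⟩ := h
  rcases lt_trichotomy i j with hl | rfl | hl
  · obtain rfl : j = i + 1 := by omega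
    exact h7 i (by omega) (by rw [Nat.even_iff]; omega) u hu v hv
  · exact h4 i hi u hu v hv huv
  · obtain rfl : i = j + 1 := by omega
    exact (h7 j (by omega) (by rw [Nat.even_iff]; omega) v hv u hu).symm

theorem strip_pick (G : SimpleGraph V) (S : Set V) (k : ℕ) (B : ℕ → Set V)
    (h : IsStripIn G S (2 * k + 1) B) :
    ∃ b : ℕ → V, ∀ i ≤ k, b i ∈ B (2 * i) ∧ b i ∈ S ∧ b i ∉ B (2 * k + 1) ∧
      ∀ j ≤ k, i ≠ j → b i ≠ b j ∧ ¬ G.Adj (b i) (b j) := by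
  have h' := h
  obtain ⟨h1, h2, -, -, ⟨x, -⟩, -, -⟩ := h'
  have : ∀ i, ∃ y, i ≤ k → y ∈ B (2 * i) := by
    intro i
    by_cases hi : i ≤ k
    · obtain ⟨y, hy⟩ := (h1 (2 * i) (by omega)).1
      exact ⟨y, fun _ => hy⟩
    · exact ⟨x, fun h => absurd h hi⟩
  choose b hb using this
  refine ⟨b, fun i hi => ⟨hb i hi, (h1 (2 * i) (by omega)).2 (hb i hi), ?_, ?_⟩⟩
  · exact Set.disjoint_left.1 (h2 (2 * i) (by omega) (2 * k + 1) (by omega) (by omega)) (hb i hi)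
  · intro j hj hij
    refine ⟨fun e => ?_, fun ha => ?_⟩
    · exact Set.disjoint_left.1 (h2 (2 * i) (by omega) (2 * j) (by omega) (by omega)) (hb i hi)
        (e ▸ hb j hj)
    · have a1 := strip_step G S _ B h (2 * i) (2 * j) (by omega) (by omega) _ _ (hb i hi)
        (hb j hj) ha
      have a2 := strip_step G S _ B h (2 * j) (2 * i) (by omega) (by omega) _ _ (hb j hj)
        (hb i hi) ha.symm
      omega

/-- For every positive integer `k` and every `G ∈ 𝒢₂(k)`, `α(G) = 2k + 2`. -/
theorem stmt4 {V : Type*} [Fintype V] (G : SimpleGraph V) (k : ℕ) (hk : 1 ≤ k)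
    (hG : MemG2 G k) : indepNum G = 2 * k + 2 := by
  obtain ⟨-, S₁, S₂, B₁, B₂, hd, hu, H₁, H₂, hE⟩ := hG
  have hS : ∀ v, v ∉ S₁ → v ∈ S₂ := by
    intro v hv
    have : v ∈ S₁ ∪ S₂ := by rw [hu]; trivial
    exact this.resolve_left hv
  have upper : ∀ n ∈ {n | ∃ S : Finset V, (∀ x ∈ S, ∀ y ∈ S, x ≠ y → ¬ G.Adj x y) ∧ S.card = n},
      n ≤ 2 * k + 2 := by
    rintro n ⟨T, hT, rfl⟩
    obtain ⟨d₁, hd₁⟩ := strip_level G S₁ _ B₁ H₁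
    obtain ⟨d₂, hd₂⟩ := strip_level G S₂ _ B₂ H₂
    have hc := Finset.card_le_card_of_injOn (s := T) (t := Finset.range (2 * k + 2))
      (fun v => if v ∈ S₁ then d₁ v / 2 else k + 1 + d₂ v / 2) ?_ ?_
    · simpa using hc
    · intro v hv
      simp only [Finset.coe_range, Set.mem_Iio]
      split_ifs with h
      · have := (hd₁ v h).1
        omega
      · have := (hd₂ v (hS v h)).1
        omega
    · intro u hu v hv huv
      by_contra hne
      refine hT u hu v hv hne ?_
      simp only at huv
      split_ifs at huv with h h' h'
      · exact strip_clique G S₁ k B₁ H₁ _ _ (hd₁ u h).1 (hd₁ v h').1 huv u v (hd₁ u h).2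
          (hd₁ v h').2 hne
      · have := (hd₁ u h).1
        omega
      · have := (hd₁ v h').1
        omega
      · exact strip_clique G S₂ k B₂ H₂ _ _ (hd₂ u (hS u h)).1 (hd₂ v (hS v h')).1 (by omega) u v
          (hd₂ u (hS u h)).2 (hd₂ v (hS v h')).2 hne
  have lower : 2 * k + 2 ∈
      {n | ∃ S : Finset V, (∀ x ∈ S, ∀ y ∈ S, x ≠ y → ¬ G.Adj x y) ∧ S.card = n} := by
    obtain ⟨b₁, hb₁⟩ := strip_pick G S₁ k B₁ H₁
    obtain ⟨b₂, hb₂⟩ := strip_pick G S₂ k B₂ H₂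
    have hx : ∀ i ≤ k, ∀ j ≤ k, b₁ i ≠ b₂ j ∧ ¬ G.Adj (b₁ i) (b₂ j) := by
      intro i hi j hj
      obtain ⟨-, p1, p2, -⟩ := hb₁ i hi
      obtain ⟨-, q1, q2, -⟩ := hb₂ j hj
      have hq : b₂ j ∉ S₁ := fun h => Set.disjoint_left.1 hd h q1
      have hp : b₁ i ∉ S₂ := fun h => Set.disjoint_left.1 hd p1 h
      refine ⟨fun e => hq (e ▸ p1), fun ha => ?_⟩
      rcases hE _ _ ha with h | h | h | h
      · exact hq h.2
      · exact hp h.1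
      · exact p2 h.1
      · exact hp ((H₂.1 _ le_rfl).2 h.1)
    let c : ℕ → V := fun n => if n ≤ k then b₁ n else b₂ (n - (k + 1))
    have hc : ∀ m < 2 * k + 2, ∀ n < 2 * k + 2, m ≠ n → c m ≠ c n ∧ ¬ G.Adj (c m) (c n) := by
      intro m hm n hn hmn
      simp only [c]
      split_ifs with h h' h'
      · exact (hb₁ m h).2.2.2 n h' hmn
      · exact hx m h _ (by omega)
      · have := hx n h' (m - (k + 1)) (by omega)
        exact ⟨this.1.symm, fun h => this.2 h.symm⟩
      · exact (hb₂ _ (by omega)).2.2.2 _ (by omega) (by omega)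
    refine ⟨(Finset.range (2 * k + 2)).image c, ?_, ?_⟩
    · intro x hx y hy hxy
      rw [Finset.mem_image] at hx hy
      obtain ⟨m, hm, rfl⟩ := hx
      obtain ⟨n, hn, rfl⟩ := hy
      exact (hc m (Finset.mem_range.1 hm) n (Finset.mem_range.1 hn) (fun e => hxy (e ▸ rfl))).2
    · rw [Finset.card_image_of_injOn, Finset.card_range]
      intro m hm n hn hmn
      by_contra hne
      exact (hc m (by simpa using hm) n (by simpa using hn) hne).1 hmn
  exact (IsGreatest.csSup_eq ⟨lower, upper⟩)
end

section
/- For every positive integer k and every graph G in the class 𝒢_2(k), the broadcast independence number satisfies α_b(G) = 8k + 4. -/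
open scoped Classical

variable {V : Type*}

theorem aux_sum {V : Type*} (f b : V → ℕ) (T : Finset V) :
    (∀ x ∈ T, ∀ y ∈ T, x ≠ y → b x ≠ b y ∧ f x + 2 * min (b x) (b y) ≤ 2 * max (b x) (b y)) →
    ∀ M, (∀ v ∈ T, b v ≤ M) → ∀ v0 ∈ T, (∀ v ∈ T, b v0 ≤ b v) →
      ∑ v ∈ T, f v + 2 * b v0 ≤ f v0 + 2 * M := by
  induction T using Finset.induction_on_max_value b with
  | empty => simp
  | insert a s ha hmax ih =>
    intro hp M hM v0 hv0 hmin
    rw [Finset.sum_insert ha]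
    by_cases hs : s.Nonempty
    · obtain ⟨w, hw, hwm⟩ := Finset.exists_max_image s b hs
      have hwa : w ≠ a := fun h => ha (h ▸ hw)
      have h1 := hp a (by simp) w (by simp [hw]) hwa.symm
      have h2 := hmax w hw
      have hv0s : v0 ∈ s := by
        rcases Finset.mem_insert.1 hv0 with h | h
        · subst h
          have := hmin w (by simp [hw])
          omega
        · exact h
      have h3 := ih (fun x hx y hy => hp x (by simp [hx]) y (by simp [hy])) (b w) hwm v0 hv0s
        (fun v hv => hmin v (by simp [hv]))
      have h4 := hM a (by simp)
      rw [min_eq_right h2, max_eq_left h2] at h1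
      omega
    · have : s = ∅ := Finset.not_nonempty_iff_eq_empty.1 hs
      subst this
      have : v0 = a := by simpa using hv0
      subst this
      have := hM v0 (by simp)
      simp; omega

theorem aux_main_s5 {V : Type*} [Fintype V] (G : SimpleGraph V) (k : ℕ) (hG : G.Connected)
    (pos : V → ℕ) (hle : ∀ v, pos v ≤ 4 * k + 3)
    (hlip : ∀ u v, G.Adj u v → pos u ≤ pos v + 1)
    (hcl : ∀ u v, u ≠ v → pos u / 2 = pos v / 2 → G.Adj u v)
    (hed : ∀ j < 2 * k + 1, ∃ s t, G.Adj s t ∧ pos s / 2 = j ∧ pos t / 2 = j + 1)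
    (x y : V) (hx : pos x = 0) (hy : pos y = 4 * k + 3) :
    broadcastIndepNum G = 8 * k + 4 := by
  have hwalk : ∀ u v, ∀ p : G.Walk u v, pos v ≤ pos u + p.length := by
    intro u v p
    induction p with
    | nil => simp
    | cons h p ih =>
      have := hlip _ _ h.symm
      simp; omega
  have hlow : ∀ u v, pos v ≤ pos u + G.dist u v := by
    intro u v
    obtain ⟨p, hp⟩ := hG.exists_walk_length_eq_dist u v
    rw [← hp]; exact hwalk u v p
  have hsame : ∀ u v, pos u / 2 = pos v / 2 → G.dist u v ≤ 1 := by
    intro u v h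
    by_cases e : u = v
    · subst e; simp
    · exact (SimpleGraph.dist_eq_one_iff_adj.2 (hcl u v e h)).le
  have hup : ∀ n u v, pos v / 2 = pos u / 2 + n → G.dist u v ≤ 2 * n + 1 := by
    intro n
    induction n with
    | zero => intro u v h; exact hsame u v (by omega)
    | succ n ih =>
      intro u v h
      have := hle v
      obtain ⟨s, t, hst, hs, ht⟩ := hed (pos u / 2) (by omega)
      have h1 := hsame u s hs.symm
      have h2 := SimpleGraph.dist_eq_one_iff_adj.2 hst
      have h3 := ih t v (by omega)
      have h4 := hG.dist_triangle (u := u) (v := s) (w := v)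
      have h5 := hG.dist_triangle (u := s) (v := t) (w := v)
      omega
  have hup2 : ∀ u v, G.dist u v + 2 * min (pos u / 2) (pos v / 2)
      ≤ 2 * max (pos u / 2) (pos v / 2) + 1 := by
    intro u v
    rcases le_total (pos u / 2) (pos v / 2) with h | h
    · have := hup (pos v / 2 - pos u / 2) u v (by omega)
      omega
    · have := hup (pos u / 2 - pos v / 2) v u (by omega)
      rw [SimpleGraph.dist_comm] at this
      omega
  have hub : ∀ f, IsIndepBroadcast G f → ∑ v, f v ≤ 8 * k + 4 := by
    rintro f ⟨hf1, hf2⟩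
    set T := Finset.univ.filter (fun v => 0 < f v) with hT
    have hsum : ∑ v, f v = ∑ v ∈ T, f v := by
      symm
      apply Finset.sum_subset (Finset.subset_univ _)
      intro v _ hv
      simp [hT] at hv
      exact hv
    have hmem : ∀ v ∈ T, 0 < f v := by intro v hv; simpa [hT] using hv
    rw [hsum]
    have hp : ∀ x ∈ T, ∀ y ∈ T, x ≠ y → pos x / 2 ≠ pos y / 2 ∧
        f x + 2 * min (pos x / 2) (pos y / 2) ≤ 2 * max (pos x / 2) (pos y / 2) := by
      intro u hu v hv huv
      have h1 := hf2 u v huv (hmem u hu) (hmem v hv)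
      have h2 := hup2 u v
      have h3 := hmem u hu
      have h4 := le_max_left (f u) (f v)
      refine ⟨?_, by omega⟩
      intro h
      have := hsame u v h
      omega
    by_cases hne : T.Nonempty
    · obtain ⟨v0, hv0, hmin⟩ := Finset.exists_min_image T (fun v => pos v / 2) hne
      have h1 := aux_sum f (fun v => pos v / 2) T hp (2 * k + 1)
        (fun v _ => by have := hle v; show pos v / 2 ≤ _; omega) v0 hv0 hmin
      by_cases hw : ∃ w ∈ T, w ≠ v0
      · obtain ⟨w, hw, hwv⟩ := hw
        have := (hp v0 hv0 w hw hwv.symm).2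
        have := hle v0
        have := hle w
        omega
      · push Not at hw
        have hTe : T = {v0} := by
          ext w; simp only [Finset.mem_singleton]
          exact ⟨hw w, fun h => h ▸ hv0⟩
        rw [hTe, Finset.sum_singleton]
        refine (hf1 v0).trans ?_
        apply Finset.sup_le
        intro w _
        have := hup2 v0 w
        have := hle v0
        have := hle w
        omega
    · rw [Finset.not_nonempty_iff_eq_empty.1 hne]; simp
  have hxy : x ≠ y := by rintro rfl; omega
  have hd := hlow x y
  have hd' : 4 * k + 3 ≤ G.dist y x := by rw [SimpleGraph.dist_comm]; omega
  apply le_antisymm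
  · apply csSup_le'
    rintro w ⟨f, hf, rfl⟩
    exact hub f hf
  · apply le_csSup
    · refine ⟨8 * k + 4, ?_⟩
      rintro w ⟨f, hf, rfl⟩
      exact hub f hf
    · refine ⟨fun v => if v = x ∨ v = y then 4 * k + 2 else 0, ⟨?_, ?_⟩, ?_⟩
      · intro v
        by_cases h : v = x ∨ v = y
        · simp only [h, if_true]
          rcases h with rfl | rfl
          · have : G.dist v y ≤ graphEcc G v := Finset.le_sup (f := fun z => G.dist v z) (Finset.mem_univ y)
            omega
          · have : G.dist v x ≤ graphEcc G v := Finset.le_sup (f := fun z => G.dist v z) (Finset.mem_univ x)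
            omega
        · simp [h]
      · intro u v huv hu hv
        have hu' : u = x ∨ u = y := by by_contra h; simp [h] at hu
        have hv' : v = x ∨ v = y := by by_contra h; simp [h] at hv
        simp only [hu', hv', if_true, max_self]
        rcases hu' with rfl | rfl <;> rcases hv' with rfl | rfl
        · exact absurd rfl huv
        · omega
        · omega
        · exact absurd rfl huv
      · rw [← Finset.sum_filter]
        have : Finset.univ.filter (fun v => v = x ∨ v = y) = {x, y} := by ext; simp
        rw [this, Finset.sum_pair hxy]; omega

theorem aux_strip {V : Type*} (G : SimpleGraph V) (S : Set V) (k : ℕ) (B : ℕ → Set V)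
    (h : IsStripIn G S (2 * k + 1) B) :
    ∃ p : V → ℕ, (∀ v ∈ S, p v ≤ 2 * k + 1) ∧
      (∀ v ∈ B (2 * k + 1), v ∈ S ∧ p v = 2 * k + 1) ∧
      (∀ u ∈ S, ∀ v ∈ S, G.Adj u v → p u ≤ p v + 1) ∧
      (∀ u ∈ S, ∀ v ∈ S, u ≠ v → p u / 2 = p v / 2 → G.Adj u v) ∧
      (∀ j < k, ∃ s ∈ S, ∃ t ∈ S, G.Adj s t ∧ p s = 2 * j + 1 ∧ p t = 2 * j + 2) ∧
      (∃ x ∈ S, p x = 0) := by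
  obtain ⟨hne, -, hS, hcl, ⟨x, hx⟩, hd, hj⟩ := h
  have hxS : x ∈ S := (hne 0 (by omega)).2 (by simp [hx])
  have hd := hd x hx
  set p : V → ℕ := fun v => if hv : v ∈ S then (G.induce S).dist ⟨x, hxS⟩ ⟨v, hv⟩ else 0 with hp
  have hpS : ∀ v (hv : v ∈ S), p v = (G.induce S).dist ⟨x, hxS⟩ ⟨v, hv⟩ := by
    intro v hv; simp [hp, hv]
  have hpB : ∀ i ≤ 2 * k + 1, ∀ v ∈ B i, v ∈ S ∧ p v = i := by
    intro i hi v hv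
    have hvS := (hne i hi).2 hv
    exact ⟨hvS, by rw [hpS v hvS]; exact hd i hi v hv hxS hvS⟩
  have hBp : ∀ v ∈ S, p v ≤ 2 * k + 1 ∧ v ∈ B (p v) := by
    intro v hv
    have hv' := hv
    rw [hS] at hv'
    simp only [Set.mem_iUnion, Set.mem_Iic] at hv'
    obtain ⟨i, hi, hvi⟩ := hv'
    rw [(hpB i hi v hvi).2]
    exact ⟨hi, hvi⟩
  have hx0 : p x = 0 := (hpB 0 (by omega) x (by simp [hx])).2
  have hreach : ∀ v (hv : v ∈ S), (G.induce S).Reachable ⟨x, hxS⟩ ⟨v, hv⟩ := by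
    intro v hv
    by_cases h0 : p v = 0
    · have := (hBp v hv).2
      rw [h0, hx] at this
      have : v = x := this
      subst this
      exact SimpleGraph.Reachable.refl _
    · apply SimpleGraph.Reachable.of_dist_ne_zero
      rw [← hpS v hv]; exact h0
  have hlip : ∀ u ∈ S, ∀ v ∈ S, G.Adj u v → p u ≤ p v + 1 := by
    intro u hu v hv huv
    obtain ⟨w, hw⟩ := (hreach v hv).exists_walk_length_eq_dist
    have ha : (G.induce S).Adj ⟨v, hv⟩ ⟨u, hu⟩ := huv.symm
    have := SimpleGraph.dist_le (w.concat ha)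
    rw [SimpleGraph.Walk.length_concat, hw] at this
    rw [hpS u hu, hpS v hv]; exact this
  refine ⟨p, fun v hv => (hBp v hv).1, hpB _ le_rfl, hlip, ?_, ?_, x, hxS, hx0⟩
  · intro u hu v hv huv he
    obtain ⟨hu1, hu2⟩ := hBp u hu
    obtain ⟨hv1, hv2⟩ := hBp v hv
    have : p u = p v ∨ (p v = p u + 1 ∧ Even (p u)) ∨ (p u = p v + 1 ∧ Even (p v)) := by
      simp only [Nat.even_iff]; omega
    rcases this with h | ⟨h, h'⟩ | ⟨h, h'⟩
    · rw [h] at hu2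
      exact hcl _ hv1 u hu2 v hv2 huv
    · rw [h] at hv2
      exact hj _ (by omega) h' u hu2 v hv2
    · rw [h] at hu2
      exact (hj _ (by omega) h' v hv2 u hu2).symm
  · intro j hjk
    obtain ⟨t, ht⟩ := (hne (2 * j + 2) (by omega)).1
    obtain ⟨htS, htp⟩ := hpB _ (by omega) t ht
    obtain ⟨w, hw⟩ := (hreach t htS).exists_walk_length_eq_dist
    rw [← hpS t htS, htp] at hw
    have hnn : ¬ w.Nil := by
      intro h; have := SimpleGraph.Walk.length_eq_zero_iff.2 h; omega
    have ha := w.adj_penultimate hnn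
    have hs := SimpleGraph.dist_le w.dropLast
    have hl : w.dropLast.length = 2 * j + 1 := by
      have := SimpleGraph.Walk.length_dropLast_add_one hnn
      omega
    refine ⟨w.penultimate, w.penultimate.2, t, htS, ha, ?_, htp⟩
    have h1 := hlip t htS _ w.penultimate.2 (SimpleGraph.Adj.symm (G := G) ha)
    rw [hl] at hs
    have h2 := hpS _ w.penultimate.2
    have h3 : p w.penultimate ≤ 2 * j + 1 := by rw [h2]; exact hs
    omega

/-- For every positive integer `k` and every `G ∈ 𝒢₂(k)`, `α_b(G) = 8k + 4`. -/
theorem stmt5 {V : Type*} [Fintype V] (G : SimpleGraph V) (k : ℕ) (hk : 1 ≤ k)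
    (hG : MemG2 G k) : broadcastIndepNum G = 8 * k + 4 := by
  obtain ⟨hc, S₁, S₂, B₁, B₂, hdis, hun, h1, h2, hadj⟩ := hG
  obtain ⟨p, hp1, hp2, hp3, hp4, hp5, x, hxS, hx⟩ := aux_strip G S₁ k B₁ h1
  obtain ⟨q, hq1, hq2, hq3, hq4, hq5, y, hyS, hy⟩ := aux_strip G S₂ k B₂ h2
  have hn : ∀ v ∈ S₂, v ∉ S₁ := fun v hv hv' => Set.disjoint_left.1 hdis hv' hv
  have hn' : ∀ v, v ∈ S₁ ∨ v ∈ S₂ := fun v => by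
    have : v ∈ S₁ ∪ S₂ := hun ▸ Set.mem_univ v
    exact this
  set pos : V → ℕ := fun v => if v ∈ S₁ then p v else 4 * k + 3 - q v with hpos
  have e1 : ∀ v ∈ S₁, pos v = p v := fun v hv => by simp [hpos, hv]
  have e2 : ∀ v ∈ S₂, pos v = 4 * k + 3 - q v := fun v hv => by simp [hpos, hn v hv]
  apply aux_main_s5 G k hc pos _ _ _ _ x y (by rw [e1 x hxS, hx]) (by rw [e2 y hyS, hy]; rfl)
  · intro v
    rcases hn' v with h | h
    · have := hp1 v h; rw [e1 v h]; omega
    · rw [e2 v h]; omega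
  · intro u v huv
    rcases hadj u v huv with ⟨hu, hv⟩ | ⟨hu, hv⟩ | ⟨hu, hv⟩ | ⟨hu, hv⟩
    · rw [e1 u hu, e1 v hv]; exact hp3 u hu v hv huv
    · have := hq3 v hv u hu huv.symm
      have := hq1 u hu
      have := hq1 v hv
      rw [e2 u hu, e2 v hv]; omega
    · obtain ⟨hu, hu'⟩ := hp2 u hu
      obtain ⟨hv, hv'⟩ := hq2 v hv
      rw [e1 u hu, e2 v hv]; omega
    · obtain ⟨hu, hu'⟩ := hq2 u hu
      obtain ⟨hv, hv'⟩ := hp2 v hv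
      rw [e2 u hu, e1 v hv]; omega
  · intro u v huv he
    rcases hn' u with hu | hu <;> rcases hn' v with hv | hv
    · rw [e1 u hu, e1 v hv] at he
      exact hp4 u hu v hv huv he
    · rw [e1 u hu, e2 v hv] at he
      have := hp1 u hu
      have := hq1 v hv
      omega
    · rw [e2 u hu, e1 v hv] at he
      have := hp1 v hv
      have := hq1 u hu
      omega
    · rw [e2 u hu, e2 v hv] at he
      have := hq1 u hu
      have := hq1 v hv
      exact hq4 u hu v hv huv (by omega)
  · intro j hj
    rcases lt_trichotomy j k with h | h | h
    · obtain ⟨s, hs, t, ht, ha, h3, h4⟩ := hp5 j h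
      refine ⟨s, t, ha, ?_, ?_⟩
      · rw [e1 s hs]; omega
      · rw [e1 t ht]; omega
    · obtain ⟨w⟩ := hc.preconnected x y
      obtain ⟨d, -, hd1, hd2⟩ := w.exists_boundary_dart S₁ hxS (hn y hyS)
      have ha := d.adj
      rcases hadj _ _ ha with ⟨hu, hv⟩ | ⟨hu, hv⟩ | ⟨hu, hv⟩ | ⟨hu, hv⟩
      · exact absurd hv hd2
      · exact absurd hd1 (hn _ hu)
      · obtain ⟨hu, hu'⟩ := hp2 _ hu
        obtain ⟨hv, hv'⟩ := hq2 _ hv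
        refine ⟨_, _, ha, ?_, ?_⟩
        · rw [e1 _ hu]; omega
        · rw [e2 _ hv]; omega
      · exact absurd (hp2 _ hv).1 hd2
    · obtain ⟨s, hs, t, ht, ha, h3, h4⟩ := hq5 (2 * k - j) (by omega)
      refine ⟨t, s, ha.symm, ?_, ?_⟩
      · rw [e2 t ht]; omega
      · rw [e2 s hs]; omega
end

section
/- For all positive integers k and ℓ with ℓ ≥ 2 and every graph G in the class 𝒢_0(k,ℓ), the independence number satisfies α(G) = kℓ + 1. -/
open scoped Classical

variable {V : Type*}

lemma strip_nonadj {V : Type*} {G : SimpleGraph V} {S : Set V} {n : ℕ} {B : ℕ → Set V}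
    (h : IsStripIn G S n B) {i i' : ℕ} (hi' : i' ≤ n) (hii : i + 2 ≤ i')
    {u v : V} (hu : u ∈ B i) (hv : v ∈ B i') : ¬ G.Adj u v := by
  obtain ⟨h1, -, -, -, ⟨x, hx⟩, h6, -⟩ := h
  intro hadj
  have hxS : x ∈ S := (h1 0 (by omega)).2 (by rw [hx]; rfl)
  have huS : u ∈ S := (h1 i (by omega)).2 hu
  have hvS : v ∈ S := (h1 i' hi').2 hv
  have du := h6 x hx i (by omega) u hu hxS huS
  have dv := h6 x hx i' hi' v hv hxS hvS
  have ha : (G.induce S).Adj ⟨u, huS⟩ ⟨v, hvS⟩ := hadj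
  have hr : (G.induce S).Reachable ⟨x, hxS⟩ ⟨v, hvS⟩ := by
    apply SimpleGraph.Reachable.of_dist_ne_zero
    omega
  have hr2 : (G.induce S).Reachable ⟨x, hxS⟩ ⟨u, huS⟩ := hr.trans ha.symm.reachable
  obtain ⟨p, hp⟩ := hr2.exists_walk_length_eq_dist
  have := SimpleGraph.dist_le (p.concat ha)
  rw [SimpleGraph.Walk.length_concat] at this
  omega

lemma strip_sep {V : Type*} {G : SimpleGraph V} {S : Set V} {n : ℕ} {B : ℕ → Set V}
    (h : IsStripIn G S n B) {i i' : ℕ} (hi : 2 * i ≤ n) (hi' : 2 * i' ≤ n) (hii : i ≠ i')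
    {u v : V} (hu : u ∈ B (2 * i)) (hv : v ∈ B (2 * i')) : u ≠ v ∧ ¬ G.Adj u v := by
  refine ⟨(h.2.1 _ hi _ hi' (by omega)).ne_of_mem hu hv, ?_⟩
  rcases lt_or_gt_of_ne hii with hl | hl
  · exact strip_nonadj h hi' (by omega) hu hv
  · exact fun ha => strip_nonadj h hi (by omega) hv hu ha.symm

/-- For all positive integers `k` and `ℓ` with `ℓ ≥ 2` and every `G ∈ 𝒢₀(k, ℓ)`,
`α(G) = kℓ + 1`. -/
theorem stmt7 {V : Type*} [Fintype V] (G : SimpleGraph V) (k ℓ : ℕ) (hk : 1 ≤ k) (hℓ : 2 ≤ ℓ)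
    (hG : MemG0 G k ℓ) : indepNum G = k * ℓ + 1 := by
  obtain ⟨S, B, R, hcov, hRS, hSS, hst, hcl, hadj⟩ := hG
  have hle : ∀ T : Finset V, (∀ x ∈ T, ∀ y ∈ T, x ≠ y → ¬ G.Adj x y) → T.card ≤ k * ℓ + 1 := by
    intro T hT
    have hc : ∀ v : V, ∃ c : Option (Fin k × Fin ℓ),
        (c = none ∧ v ∈ R ∪ ⋃ j, B j (2 * k)) ∨
        ∃ i j, c = some (i, j) ∧ (v ∈ B j (2 * i.1) ∨ v ∈ B j (2 * i.1 + 1)) := by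
      intro v
      have hv : v ∈ R ∪ ⋃ j, S j := by rw [hcov]; trivial
      rcases hv with hv | hv
      · exact ⟨none, Or.inl ⟨rfl, Or.inl hv⟩⟩
      · obtain ⟨j, hj⟩ := Set.mem_iUnion.1 hv
        rw [(hst j).2.2.1] at hj
        simp only [Set.mem_iUnion, Set.mem_Iic] at hj
        obtain ⟨i, hi, hvi⟩ := hj
        by_cases hik : i = 2 * k
        · subst hik
          exact ⟨none, Or.inl ⟨rfl, Or.inr (Set.mem_iUnion.2 ⟨j, hvi⟩)⟩⟩
        · refine ⟨some (⟨i / 2, by omega⟩, j), Or.inr ⟨_, _, rfl, ?_⟩⟩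
          rcases Nat.even_or_odd' i with ⟨m, rfl | rfl⟩
          · left
            have : 2 * (2 * m / 2) = 2 * m := by omega
            simpa only [this] using hvi
          · right
            have : 2 * ((2 * m + 1) / 2) + 1 = 2 * m + 1 := by omega
            simpa only [this] using hvi
    choose f hf using hc
    have hinj : Set.InjOn f T := by
      intro u hu v hv huv
      by_contra hne
      apply hT u hu v hv hne
      rcases hf u with ⟨e, h1⟩ | ⟨i, j, e, h1⟩ <;> rcases hf v with ⟨e', h2⟩ | ⟨i', j', e', h2⟩
      · exact hcl u v hne h1 h2
      · rw [huv, e'] at e; cases e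
      · rw [huv, e'] at e; cases e
      · rw [huv, e'] at e
        cases e
        have hi := i.2
        obtain ⟨-, -, -, h4, -, -, h7⟩ := hst j
        rcases h1 with h1 | h1 <;> rcases h2 with h2 | h2
        · exact h4 _ (by omega) u h1 v h2 hne
        · exact h7 _ (by omega) (even_two_mul _) u h1 v h2
        · exact (h7 _ (by omega) (even_two_mul _) v h2 u h1).symm
        · exact h4 _ (by omega) u h1 v h2 hne
    have := Finset.card_le_card_of_injOn f (t := Finset.univ) (fun _ _ => Finset.mem_coe.2 (Finset.mem_univ _)) hinj
    simpa using this
  have hb : ∀ (j : Fin ℓ) (i : ℕ), ∃ b, i ≤ 2 * k → b ∈ B j i := by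
    intro j i
    by_cases h : i ≤ 2 * k
    · obtain ⟨b, hb⟩ := ((hst j).1 i h).1
      exact ⟨b, fun _ => hb⟩
    · obtain ⟨b, hb⟩ := ((hst j).1 0 (by omega)).1
      exact ⟨b, fun h' => absurd h' h⟩
  choose b hb using hb
  let J : Option (Fin k × Fin ℓ) → Fin ℓ := fun c => c.elim ⟨0, by omega⟩ Prod.snd
  let I : Option (Fin k × Fin ℓ) → ℕ := fun c => c.elim k (fun p => p.1.1)
  have hI : ∀ c, I c ≤ k := by
    rintro (_ | ⟨i, j⟩)
    · exact le_rfl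
    · exact i.2.le
  have hIJ : ∀ c c', J c = J c' → I c = I c' → c = c' := by
    rintro (_ | ⟨i, j⟩) (_ | ⟨i', j'⟩) h h'
    · rfl
    · exact absurd h' i'.2.ne'
    · exact absurd h' i.2.ne
    · have h1 : j = j' := h
      have h2 : i = i' := Fin.ext h'
      rw [h1, h2]
  have hIk : ∀ c, I c = k → c = none := by
    rintro (_ | ⟨i, j⟩) h
    · rfl
    · exact absurd h i.2.ne
  let g : Option (Fin k × Fin ℓ) → V := fun c => b (J c) (2 * I c)
  have hg : ∀ c, g c ∈ B (J c) (2 * I c) := fun c => hb _ _ (by have := hI c; omega)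
  have hgS : ∀ c, g c ∈ S (J c) := fun c => ((hst _).1 _ (by have := hI c; omega)).2 (hg c)
  have hJ : ∀ c j, g c ∈ S j → J c = j := by
    intro c j h
    by_contra hne
    exact (hSS hne).ne_of_mem (hgS c) h rfl
  have hlast : ∀ c, g c ∈ R ∪ ⋃ j, B j (2 * k) → c = none := by
    rintro c (h | h)
    · exact absurd rfl ((hRS (J c)).ne_of_mem h (hgS c))
    · obtain ⟨j, hj⟩ := Set.mem_iUnion.1 h
      have := hJ c j (((hst _).1 _ le_rfl).2 hj)
      subst this
      apply hIk
      by_contra hne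
      exact (strip_sep (hst (J c)) (by have := hI c; omega) le_rfl hne (hg c) hj).1 rfl
  have hsep : ∀ c c', c ≠ c' → g c ≠ g c' ∧ ¬ G.Adj (g c) (g c') := by
    intro c c' hne
    by_cases hj : J c = J c'
    · have h2 := hg c
      rw [hj] at h2
      exact strip_sep (hst (J c')) (by have := hI c; omega) (by have := hI c'; omega)
        (fun h => hne (hIJ _ _ hj h)) h2 (hg c')
    · refine ⟨(hSS hj).ne_of_mem (hgS c) (hgS c'), fun ha => ?_⟩
      rcases hadj _ _ ha with ⟨j, h1, h2⟩ | ⟨h1, h2⟩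
      · exact hj ((hJ _ _ h1).trans (hJ _ _ h2).symm)
      · exact hne ((hlast _ h1).trans (hlast _ h2).symm)
  have hginj : Function.Injective g := by
    intro c c' h
    by_contra hne
    exact (hsep c c' hne).1 h
  apply IsGreatest.csSup_eq
  constructor
  · refine ⟨Finset.univ.image g, ?_, ?_⟩
    · intro x hx y hy hxy
      simp only [Finset.mem_image, Finset.mem_univ, true_and] at hx hy
      obtain ⟨c, rfl⟩ := hx
      obtain ⟨c', rfl⟩ := hy
      exact (hsep c c' (fun h => hxy (by rw [h]))).2
    · rw [Finset.card_image_of_injective _ hginj]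
      simp
  · rintro n ⟨T, hT, rfl⟩
    exact hle T hT
end

section
/- For all positive integers k and ℓ with ℓ ≥ 2 and every graph G in the class 𝒢_0(k,ℓ), the broadcast independence number satisfies α_b(G) = 4kℓ. -/
open scoped Classical

variable {V : Type*}

/-- Abstract layered description of the graphs in question. -/
structure Layered {V : Type*} (G : SimpleGraph V) (k ℓ : ℕ) (idx : V → Option (Fin ℓ))
    (L : V → ℕ) (x : Fin ℓ → V) : Prop where
  le : ∀ v, L v ≤ 2 * k
  lnone : ∀ v, idx v = none → L v = 2 * k
  xi : ∀ j, idx (x j) = some j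
  xl : ∀ j, L (x j) = 0
  xu : ∀ j v, idx v = some j → L v = 0 → v = x j
  top : ∀ j, ∃ t, idx t = some j ∧ L t = 2 * k
  cl : ∀ u v, u ≠ v → L u = 2 * k → L v = 2 * k → G.Adj u v
  same : ∀ j u v, idx u = some j → idx v = some j → L u = L v → u ≠ v → G.Adj u v
  down : ∀ j v n, idx v = some j → L v = n + 1 → ∃ u, idx u = some j ∧ L u = n ∧ G.Adj v u
  adj : ∀ u v, G.Adj u v → (idx u = idx v ∧ L u ≤ L v + 1 ∧ L v ≤ L u + 1) ∨
    (L u = 2 * k ∧ L v = 2 * k)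

/-- There is a walk of length at most `n`. -/
def Near {V : Type*} (G : SimpleGraph V) (n : ℕ) (u v : V) : Prop :=
  ∃ w : G.Walk u v, w.length ≤ n

lemma Near.dist {V : Type*} {G : SimpleGraph V} {n : ℕ} {u v : V} (h : Near G n u v) :
    G.dist u v ≤ n := by
  obtain ⟨w, hw⟩ := h
  exact (SimpleGraph.dist_le w).trans hw

lemma Near.trans {V : Type*} {G : SimpleGraph V} {n m : ℕ} {u v w : V} (h : Near G n u v)
    (h' : Near G m v w) : Near G (n + m) u w := by
  obtain ⟨p, hp⟩ := h
  obtain ⟨q, hq⟩ := h'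
  exact ⟨p.append q, by rw [SimpleGraph.Walk.length_append]; omega⟩

lemma Near.symm {V : Type*} {G : SimpleGraph V} {n : ℕ} {u v : V} (h : Near G n u v) :
    Near G n v u := by
  obtain ⟨p, hp⟩ := h
  exact ⟨p.reverse, by simpa using hp⟩

lemma Near.mono {V : Type*} {G : SimpleGraph V} {n m : ℕ} {u v : V} (h : Near G n u v)
    (hm : n ≤ m) : Near G m u v := by
  obtain ⟨p, hp⟩ := h
  exact ⟨p, hp.trans hm⟩

lemma Near.refl {V : Type*} (G : SimpleGraph V) (u : V) : Near G 0 u u := ⟨.nil, by simp⟩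

lemma Near.adj {V : Type*} {G : SimpleGraph V} {u v : V} (h : G.Adj u v) : Near G 1 u v :=
  ⟨.cons h .nil, by simp⟩

namespace Layered
variable {V : Type*} {G : SimpleGraph V} {k ℓ : ℕ} {idx : V → Option (Fin ℓ)}
    {L : V → ℕ} {x : Fin ℓ → V}

lemma desc (H : Layered G k ℓ idx L x) (j : Fin ℓ) (n : ℕ) : ∀ (d : ℕ) (v : V),
    idx v = some j → L v = n + d → ∃ u, idx u = some j ∧ L u = n ∧ Near G d v u := by
  intro d
  induction d with
  | zero => intro v hv h; exact ⟨v, hv, h, Near.refl G v⟩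
  | succ d ih =>
    intro v hv h
    obtain ⟨u, hu, hl, ha⟩ := H.down j v (n + d) hv h
    obtain ⟨w, hw, hl', hn⟩ := ih u hu hl
    exact ⟨w, hw, hl', ((Near.adj ha).trans hn).mono (by omega)⟩

lemma near (H : Layered G k ℓ idx L x) {j : Fin ℓ} {u v : V} (hu : idx u = some j)
    (hv : idx v = some j) (h : L u ≤ L v) : Near G (L v - L u + 1) v u := by
  obtain ⟨w, hw, hl, hn⟩ := H.desc j (L u) (L v - L u) v hv (by omega)
  by_cases e : w = u
  · subst e; exact hn.mono (by omega)
  · exact hn.trans (Near.adj (H.same j w u hw hu hl e))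

lemma near_center (H : Layered G k ℓ idx L x) (hk : 1 ≤ k) (u : V) :
    ∃ c, L c = 2 * k ∧ Near G (2 * k) u c := by
  rcases hj : idx u with _ | j
  · exact ⟨u, H.lnone u hj, (Near.refl G u).mono (by omega)⟩
  · obtain ⟨t, ht, hl⟩ := H.top j
    refine ⟨t, hl, ?_⟩
    by_cases h0 : L u = 0
    · obtain ⟨w, hw, hl', hn⟩ := H.desc j 0 (2 * k) t ht (by omega)
      rw [H.xu j u hj h0, ← H.xu j w hw hl']
      exact hn.symm
    · have := H.le u
      exact (H.near hj ht (by omega)).symm.mono (by omega)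

lemma near_top (H : Layered G k ℓ idx L x) {u c : V} {j : Fin ℓ} (hu : idx u = some j)
    (hc : L c = 2 * k) : Near G (2 * k - L u + 2) u c := by
  obtain ⟨t, ht, hl⟩ := H.top j
  have := H.le u
  have h1 := (H.near hu ht (by omega)).symm
  by_cases e : t = c
  · subst e; exact h1.mono (by omega)
  · exact (h1.trans (Near.adj (H.cl t c e hl hc))).mono (by omega)

lemma near_top' (H : Layered G k ℓ idx L x) (hk : 1 ≤ k) {u c : V}
    (hc : L c = 2 * k) : Near G (2 * k + 1) u c := by
  obtain ⟨t, hl, h1⟩ := H.near_center hk u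
  by_cases e : t = c
  · subst e; exact h1.mono (by omega)
  · exact (h1.trans (Near.adj (H.cl t c e hl hc)))

lemma near_all (H : Layered G k ℓ idx L x) (hk : 1 ≤ k) (u v : V) : Near G (4 * k + 1) u v := by
  obtain ⟨t, hl, h1⟩ := H.near_center hk u
  obtain ⟨s, hs, h2⟩ := H.near_center hk v
  exact ((H.near_top' hk hs).trans h2.symm).mono (by omega)

lemma phi (H : Layered G k ℓ idx L x) (j : Fin ℓ) {u v : V} (w : G.Walk u v) :
    (if idx v = some j then L v else 4 * k + 1 - L v) ≤
      (if idx u = some j then L u else 4 * k + 1 - L u) + w.length := by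
  induction w with
  | nil => simp
  | @cons a b c h p ih =>
    rw [SimpleGraph.Walk.length_cons]
    refine ih.trans ?_
    have h1 := H.le a
    have h2 := H.le b
    rcases H.adj a b h with ⟨e, h3, h4⟩ | ⟨h3, h4⟩
    · rw [e]; split_ifs <;> omega
    · split_ifs <;> omega

lemma dist_x (H : Layered G k ℓ idx L x) (hk : 1 ≤ k) {i j : Fin ℓ} (hij : i ≠ j) :
    4 * k < G.dist (x i) (x j) := by
  obtain ⟨w, -⟩ := H.near_all hk (x i) (x j)
  obtain ⟨p, hp⟩ := (SimpleGraph.Walk.reachable w).exists_walk_length_eq_dist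
  have := H.phi i p
  rw [if_neg (by rw [H.xi]; simpa using hij.symm), if_pos (H.xi i), H.xl, H.xl] at this
  omega

end Layered

lemma sum_le_of_gap {V : Type*} (f L : V → ℕ) (s : Finset V) : ∀ M : ℕ,
    (∀ u ∈ s, ∀ v ∈ s, u ≠ v → L u ≤ L v → f u + L u ≤ L v) → (∀ u ∈ s, f u + L u ≤ M) →
    ∑ u ∈ s, f u ≤ M := by
  induction s using Finset.induction_on_max_value L with
  | empty => simp
  | insert a s ha hm ih =>
    intro M h1 h2
    rw [Finset.sum_insert ha]
    have := ih (L a) (fun u hu v hv => h1 u (by simp [hu]) v (by simp [hv]))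
      (fun u hu => h1 u (by simp [hu]) a (by simp) (by rintro rfl; exact ha hu) (hm u hu))
    have := h2 a (by simp)
    omega

lemma sum_two {V : Type*} (f L : V → ℕ) (s : Finset V)
    (h : ∀ u ∈ s, ∀ v ∈ s, u ≠ v → L u ≤ L v → f u + L u ≤ L v ∧ f v + L u ≤ L v) :
    (∑ u ∈ s, f u = 0) ∨ (∃ u ∈ s, ∑ u ∈ s, f u = f u) ∨ ∃ m ∈ s, ∑ u ∈ s, f u ≤ 2 * L m := by
  rcases s.eq_empty_or_nonempty with rfl | hs
  · simp
  right
  obtain ⟨m, hm, hmax⟩ := s.exists_max_image L hs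
  by_cases hh : ∃ a ∈ s, a ≠ m
  · obtain ⟨a, ha, hne⟩ := hh
    refine Or.inr ⟨m, hm, ?_⟩
    rw [← Finset.add_sum_erase s f hm]
    have h1 := (h a ha m hm hne (hmax a ha)).2
    have h2 := sum_le_of_gap f L (s.erase m) (L m)
      (fun u hu v hv hn hl => (h u (Finset.mem_of_mem_erase hu) v (Finset.mem_of_mem_erase hv) hn hl).1)
      (fun u hu => (h u (Finset.mem_of_mem_erase hu) m hm (Finset.ne_of_mem_erase hu)
        (hmax u (Finset.mem_of_mem_erase hu))).1)
    omega
  · push Not at hh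
    refine Or.inl ⟨m, hm, ?_⟩
    have : s = {m} := by
      ext a; simp only [Finset.mem_singleton]
      exact ⟨hh a, by rintro rfl; exact hm⟩
    rw [this]; simp

lemma Layered.upper {V : Type*} [Fintype V] {G : SimpleGraph V} {k ℓ : ℕ}
    {idx : V → Option (Fin ℓ)} {L : V → ℕ} {x : Fin ℓ → V} (H : Layered G k ℓ idx L x)
    (hk : 1 ≤ k) (hℓ : 2 ≤ ℓ) (f : V → ℕ) (hf : IsIndepBroadcast G f) :
    ∑ v, f v ≤ 4 * k * ℓ := by
  obtain ⟨hB1, hB2⟩ := hf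
  have hbig : 4 * k + 1 ≤ 4 * k * ℓ := by nlinarith
  have hecc : ∀ v, f v ≤ 4 * k + 1 := fun v => (hB1 v).trans
    (Finset.sup_le fun y _ => (H.near_all hk v y).dist)
  by_cases h1 : ∀ u v, 0 < f u → 0 < f v → u = v
  · by_cases h2 : ∃ u, 0 < f u
    · obtain ⟨u, hu⟩ := h2
      rw [Finset.sum_eq_single u]
      · exact (hecc u).trans hbig
      · intro b _ hb
        by_contra hne
        exact hb (h1 b u (Nat.pos_of_ne_zero hne) hu)
      · simp
    · push Not at h2
      rw [Finset.sum_eq_zero (fun v _ => by have := h2 v; omega)]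
      omega
  have hother : ∀ u, 0 < f u → ∃ v, v ≠ u ∧ 0 < f v := by
    intro u hu
    by_contra hc
    push Not at hc
    apply h1
    intro a b ha hb
    have h3 : a = u := by by_contra hn; have := hc a hn; omega
    have h4 : b = u := by by_contra hn; have := hc b hn; omega
    rw [h3, h4]
  have hpair : ∀ u v n, u ≠ v → 0 < f u → 0 < f v → Near G n u v → f u < n ∧ f v < n := by
    intro u v n hne hu hv hn
    have := hB2 u v hne hu hv
    have := hn.dist
    have := le_max_left (f u) (f v)
    have := le_max_right (f u) (f v)
    omega
  have h4k : ∀ u, f u ≤ 4 * k := by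
    intro u
    by_cases hu : 0 < f u
    · obtain ⟨v, hv, hfv⟩ := hother u hu
      have := hpair v u _ hv hfv hu (H.near_all hk v u)
      omega
    · omega
  set P : Option (Fin ℓ) → Finset V := fun o => Finset.univ.filter fun v => idx v = o ∧ 0 < f v
    with hP
  have hmem : ∀ o v, v ∈ P o ↔ idx v = o ∧ 0 < f v := by intro o v; simp [hP]
  have hsum : ∑ v, f v = ∑ o, ∑ v ∈ P o, f v := by
    rw [← Finset.sum_fiberwise Finset.univ idx f]
    refine Finset.sum_congr rfl fun o _ => ?_
    symm
    apply Finset.sum_subset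
    · intro v hv; simp only [Finset.mem_filter, Finset.mem_univ, true_and]
      exact ((hmem o v).1 hv).1
    · intro v hv hv'
      simp only [Finset.mem_filter, Finset.mem_univ, true_and] at hv
      by_contra hne
      exact hv' ((hmem o v).2 ⟨hv, Nat.pos_of_ne_zero hne⟩)
  rw [hsum, Fintype.sum_option]
  have hT : ∀ j : Fin ℓ, _ := fun j => sum_two f L (P (some j)) (by
    intro u hu v hv hne hl
    rw [hmem] at hu hv
    have := hpair v u _ hne.symm hv.2 hu.2 (H.near hu.1 hv.1 hl)
    omega)
  have hT4 : ∀ j, ∑ v ∈ P (some j), f v ≤ 4 * k := by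
    intro j
    rcases hT j with h | ⟨u, hu, h⟩ | ⟨m, hm, h⟩
    · omega
    · have := h4k u; omega
    · have := H.le m; omega
  by_cases hR : ∃ r, idx r = none ∧ 0 < f r
  · obtain ⟨r, hr, hfr⟩ := hR
    have hrs : ∑ v ∈ P none, f v = f r := by
      apply Finset.sum_eq_single_of_mem r ((hmem _ _).2 ⟨hr, hfr⟩)
      intro b hb hne
      rw [hmem] at hb
      have := hpair b r 1 hne hb.2 hfr
        (Near.adj (H.cl b r hne (H.lnone _ hb.1) (H.lnone _ hr)))
      omega
    rw [hrs]
    have hr2 : f r ≤ 2 * k := by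
      obtain ⟨v, hv, hfv⟩ := hother r hfr
      have := hpair v r _ hv hfv hfr (H.near_top' hk (H.lnone _ hr))
      omega
    have hTr : ∀ j, ∑ v ∈ P (some j), f v + f r ≤ 4 * k := by
      intro j
      rcases hT j with h | ⟨u, hu, h⟩ | ⟨m, hm, h⟩
      · omega
      · rw [hmem] at hu
        have hne : u ≠ r := by rintro rfl; rw [hr] at hu; simp at hu
        have := hpair u r _ hne hu.2 hfr (H.near_top' hk (H.lnone _ hr))
        omega
      · rw [hmem] at hm
        have hne : m ≠ r := by rintro rfl; rw [hr] at hm; simp at hm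
        have h5 := hpair m r _ hne hm.2 hfr (H.near_top hm.1 (H.lnone _ hr))
        have h6 := H.le m
        by_cases h7 : L m = 2 * k
        · have := hpair m r 1 hne hm.2 hfr (Near.adj (H.cl m r hne h7 (H.lnone _ hr)))
          omega
        · omega
    let j0 : Fin ℓ := ⟨0, by omega⟩
    calc f r + ∑ j, ∑ v ∈ P (some j), f v
        = ∑ j, ((∑ v ∈ P (some j), f v) + if j = j0 then f r else 0) := by
          rw [Finset.sum_add_distrib]; simp [add_comm]
      _ ≤ ∑ j : Fin ℓ, 4 * k := by
          refine Finset.sum_le_sum fun j _ => ?_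
          split_ifs
          · exact hTr j
          · exact hT4 j
      _ = 4 * k * ℓ := by simp [mul_comm]
  · have hrs : P none = ∅ := by
      ext v; rw [hmem]; simp only [Finset.notMem_empty, iff_false]
      exact fun h => hR ⟨v, h⟩
    rw [hrs, Finset.sum_empty, zero_add]
    calc _ ≤ ∑ j : Fin ℓ, 4 * k := Finset.sum_le_sum fun j _ => hT4 j
      _ = 4 * k * ℓ := by simp [mul_comm]

lemma Layered.lower {V : Type*} [Fintype V] {G : SimpleGraph V} {k ℓ : ℕ}
    {idx : V → Option (Fin ℓ)} {L : V → ℕ} {x : Fin ℓ → V} (H : Layered G k ℓ idx L x)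
    (hk : 1 ≤ k) (hℓ : 2 ≤ ℓ) :
    ∃ f : V → ℕ, IsIndepBroadcast G f ∧ ∑ v, f v = 4 * k * ℓ := by
  have hinj : Function.Injective x := by
    intro i j h
    have := H.xi i
    rw [h, H.xi] at this
    exact (Option.some.inj this).symm
  refine ⟨fun v => if v ∈ Finset.univ.image x then 4 * k else 0, ⟨?_, ?_⟩, ?_⟩
  · intro v
    simp only
    split_ifs with h
    · obtain ⟨i, -, rfl⟩ := Finset.mem_image.1 h
      obtain ⟨j, hj⟩ : ∃ j : Fin ℓ, i ≠ j := by
        have : Nontrivial (Fin ℓ) := Fin.nontrivial_iff_two_le.2 hℓ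
        obtain ⟨j, hj⟩ := exists_ne i
        exact ⟨j, hj.symm⟩
      exact (H.dist_x hk hj).le.trans
        (Finset.le_sup (f := fun y => G.dist (x i) y) (Finset.mem_univ (x j)))
    · omega
  · intro u v hne hu hv
    simp only at hu hv ⊢
    split_ifs at hu hv with h1 h2
    · rw [if_pos h1, if_pos h2, max_self]
      obtain ⟨i, -, rfl⟩ := Finset.mem_image.1 h1
      obtain ⟨j, -, rfl⟩ := Finset.mem_image.1 h2
      exact H.dist_x hk (fun e => hne (by rw [e]))
    all_goals omega
  · rw [Finset.sum_ite_mem, Finset.univ_inter, Finset.sum_const, Finset.card_image_of_injective _ hinj]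
    simp [mul_comm]

lemma strip_adj {V : Type*} {G : SimpleGraph V} {S : Set V} {n : ℕ} {B : ℕ → Set V}
    (h : IsStripIn G S n B) {a b : ℕ} (ha : a ≤ n) (hb : b ≤ n) {u v : V} (hu : u ∈ B a)
    (hv : v ∈ B b) (huv : G.Adj u v) : b ≤ a + 1 := by
  obtain ⟨h1, h2, h3, h4, ⟨x, hx⟩, h6, h7⟩ := h
  have hxS : x ∈ S := (h1 0 (by omega)).2 (by rw [hx]; rfl)
  have huS := (h1 a ha).2 hu
  have hvS := (h1 b hb).2 hv
  have d1 := h6 x hx a ha u hu hxS huS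
  have d2 := h6 x hx b hb v hv hxS hvS
  have hr : (G.induce S).Reachable ⟨x, hxS⟩ ⟨u, huS⟩ := by
    rcases Nat.eq_zero_or_pos a with rfl | h0
    · rw [hx] at hu
      obtain rfl : u = x := hu
      exact SimpleGraph.Reachable.refl _
    · exact SimpleGraph.Reachable.of_dist_ne_zero (by omega)
  obtain ⟨p, hp⟩ := hr.exists_walk_length_eq_dist
  have hadj : (G.induce S).Adj ⟨u, huS⟩ ⟨v, hvS⟩ := huv
  have := SimpleGraph.dist_le (p.concat hadj)
  rw [SimpleGraph.Walk.length_concat] at this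
  omega

lemma strip_down {V : Type*} {G : SimpleGraph V} {S : Set V} {n : ℕ} {B : ℕ → Set V}
    (h : IsStripIn G S n B) {b : ℕ} (hb : b + 1 ≤ n) {v : V}
    (hv : v ∈ B (b + 1)) : ∃ u ∈ B b, G.Adj v u := by
  have hh := h
  obtain ⟨h1, h2, h3, h4, ⟨x, hx⟩, h6, h7⟩ := h
  have hxS : x ∈ S := (h1 0 (by omega)).2 (by rw [hx]; rfl)
  have hvS := (h1 _ hb).2 hv
  have d2 := h6 x hx _ hb v hv hxS hvS
  have hr : (G.induce S).Reachable ⟨x, hxS⟩ ⟨v, hvS⟩ :=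
    SimpleGraph.Reachable.of_dist_ne_zero (by omega)
  obtain ⟨p, hp⟩ := hr.symm.exists_walk_length_eq_dist
  rw [SimpleGraph.dist_comm, d2] at hp
  cases p with
  | nil => simp at hp
  | @cons _ w _ hadj q =>
    obtain ⟨w, hw⟩ := w
    rw [SimpleGraph.Walk.length_cons] at hp
    have hvw : G.Adj v w := hadj
    have hw' := hw
    rw [h3] at hw'
    simp only [Set.mem_iUnion, Set.mem_Iic] at hw'
    obtain ⟨i, hi, hwi⟩ := hw'
    have d3 := h6 x hx i hi w hwi hxS hw
    have := SimpleGraph.dist_le q.reverse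
    rw [SimpleGraph.Walk.length_reverse] at this
    have := strip_adj hh hi hb hwi hv hvw.symm
    obtain rfl : i = b := by omega
    exact ⟨w, hwi, hvw⟩

lemma exists_layered {V : Type*} {G : SimpleGraph V} {k ℓ : ℕ} (hG : MemG0 G k ℓ) :
    ∃ (idx : V → Option (Fin ℓ)) (L : V → ℕ) (x : Fin ℓ → V), Layered G k ℓ idx L x := by
  obtain ⟨S, B, R, hcov, hRS, hSS, hst, hcl, hadj⟩ := hG
  have hB : ∀ v, ∃ (o : Option (Fin ℓ)) (n : ℕ), n ≤ 2 * k ∧ 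
      ((o = none ∧ v ∈ R ∧ n = 2 * k) ∨ ∃ j, o = some j ∧ v ∈ B j n) := by
    intro v
    have : v ∈ R ∪ ⋃ j, S j := by rw [hcov]; trivial
    rcases this with h | h
    · exact ⟨none, 2 * k, le_rfl, Or.inl ⟨rfl, h, rfl⟩⟩
    · obtain ⟨j, hj⟩ := Set.mem_iUnion.1 h
      rw [(hst j).2.2.1] at hj
      simp only [Set.mem_iUnion, Set.mem_Iic] at hj
      obtain ⟨i, hi, hv⟩ := hj
      exact ⟨some j, i, hi, Or.inr ⟨j, rfl, hv⟩⟩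
  choose idx L hL hI using hB
  have hs : ∀ v j, idx v = some j → v ∈ B j (L v) := by
    intro v j hj
    rcases hI v with ⟨h, -⟩ | ⟨i, h, hv⟩
    · rw [h] at hj; cases hj
    · rw [h] at hj; cases hj; exact hv
  have hBS : ∀ j n, n ≤ 2 * k → B j n ⊆ S j := fun j n hn => ((hst j).1 n hn).2
  have hS : ∀ v j, v ∈ S j → idx v = some j := by
    intro v j hj
    rcases hI v with ⟨h, hv, -⟩ | ⟨i, h, hv⟩
    · exact absurd hj (Set.disjoint_left.1 (hRS j) hv)
    · rw [h]
      by_contra hne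
      have hne' : i ≠ j := fun e => hne (by rw [e])
      exact Set.disjoint_left.1 (hSS hne') (hBS i _ (hL v) hv) hj
  have hBL : ∀ v j n, n ≤ 2 * k → v ∈ B j n → idx v = some j ∧ L v = n := by
    intro v j n hn hv
    have h1 := hS v j (hBS j n hn hv)
    refine ⟨h1, ?_⟩
    by_contra hne
    exact Set.disjoint_left.1 ((hst j).2.1 _ (hL v) n hn hne) (hs v j h1) hv
  have hN : ∀ v, idx v = none → v ∈ R ∧ L v = 2 * k := by
    intro v hv
    rcases hI v with ⟨-, h⟩ | ⟨i, h, -⟩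
    · exact h
    · rw [h] at hv; cases hv
  have hC : ∀ v, v ∈ R ∪ ⋃ j, B j (2 * k) ↔ L v = 2 * k := by
    intro v
    constructor
    · rintro (h | h)
      · rcases hI v with ⟨-, -, h'⟩ | ⟨i, h', hv⟩
        · exact h'
        · exact absurd (hBS i _ (hL v) hv) (Set.disjoint_left.1 (hRS i) h)
      · obtain ⟨j, hj⟩ := Set.mem_iUnion.1 h
        exact (hBL v j _ le_rfl hj).2
    · intro h
      rcases hI v with ⟨-, h', -⟩ | ⟨i, h', hv⟩
      · exact Or.inl h'
      · rw [h] at hv; exact Or.inr (Set.mem_iUnion.2 ⟨i, hv⟩)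
  choose x hx using fun j => (hst j).2.2.2.2.1
  have hx0 : ∀ j, x j ∈ B j 0 := fun j => by rw [hx]; rfl
  refine ⟨idx, L, x, ⟨hL, fun v h => (hN v h).2, fun j => (hBL _ j 0 (by omega) (hx0 j)).1,
    fun j => (hBL _ j 0 (by omega) (hx0 j)).2, ?_, ?_, ?_, ?_, ?_, ?_⟩⟩
  · intro j v hj h0
    have := hs v j hj
    rw [h0, hx] at this
    exact this
  · intro j
    obtain ⟨t, ht⟩ := ((hst j).1 (2 * k) le_rfl).1
    exact ⟨t, hBL t j _ le_rfl ht⟩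
  · intro u v hne hu hv
    exact hcl u v hne ((hC u).2 hu) ((hC v).2 hv)
  · intro j u v hu hv hl hne
    have h1 := hs u j hu
    have h2 := hs v j hv
    rw [← hl] at h2
    exact (hst j).2.2.2.1 _ (hL u) u h1 v h2 hne
  · intro j v n hv hn
    have h1 := hs v j hv
    have h2 := hL v
    rw [hn] at h1
    obtain ⟨u, hu, ha⟩ := strip_down (hst j) (by omega) h1
    obtain ⟨h3, h4⟩ := hBL u j n (by omega) hu
    exact ⟨u, h3, h4, ha⟩
  · intro u v huv
    rcases hadj u v huv with ⟨j, hu, hv⟩ | ⟨hu, hv⟩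
    · have h1 := hS u j hu
      have h2 := hS v j hv
      exact Or.inl ⟨h1.trans h2.symm,
        strip_adj (hst j) (hL v) (hL u) (hs v j h2) (hs u j h1) huv.symm,
        strip_adj (hst j) (hL u) (hL v) (hs u j h1) (hs v j h2) huv⟩
    · exact Or.inr ⟨(hC u).1 hu, (hC v).1 hv⟩

/-- For all positive integers `k` and `ℓ` with `ℓ ≥ 2` and every `G ∈ 𝒢₀(k, ℓ)`,
`α_b(G) = 4kℓ`. -/
theorem stmt8 {V : Type*} [Fintype V] (G : SimpleGraph V) (k ℓ : ℕ) (hk : 1 ≤ k) (hℓ : 2 ≤ ℓ)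
    (hG : MemG0 G k ℓ) : broadcastIndepNum G = 4 * k * ℓ := by
  obtain ⟨idx, L, x, H⟩ := exists_layered hG
  apply IsGreatest.csSup_eq
  refine ⟨H.lower hk hℓ, ?_⟩
  rintro w ⟨f, hf, rfl⟩
  exact H.upper hk hℓ f hf
end
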